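/- The sequence 0 → ℤ → ℤ[X] ⊕ ℤ → ℤ[Λ] → J[R] → 0 is exact, where the first map sends 1 to (ν_X(1), −2), the second map sends (ξ, n) to τ(ξ) + ν_Λ(n), and the third map is the composite of the relative augmentation ε_{Λ/R} : ℤ[Λ] → ℤ[R] with the quotient map ℤ[R] → J[R] = coker ν_R. -/

import Mathlib

open Finsupp LinearMap Function

/-- The set of 2-element subsets of a finite set `X`. -/
abbrev Pairs (X : Type) : Type := {s : Finset X // s.card = 2}

/-- The complement map `γ : Λ → Λ` sending a 2-element subset of a 4-element set to its
complement. -/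
def gammaMap (X : Type) [Fintype X] [DecidableEq X] (hX : Fintype.card X = 4) :
    Pairs X → Pairs X :=
  fun l => ⟨(l : Finset X)ᶜ, by rw [Finset.card_compl, l.2, hX]⟩

/-- The augmentation `ε_E : ℤ[E] → ℤ`. -/
noncomputable def epsAug (E : Type) : (E →₀ ℤ) →ₗ[ℤ] ℤ :=
  Finsupp.lsum ℤ fun _ => LinearMap.id

/-- The norm `ν_E : ℤ → ℤ[E]`, `1 ↦ Σ_{e ∈ E} e`. -/
noncomputable def nuNorm (E : Type) [Fintype E] : ℤ →ₗ[ℤ] (E →₀ ℤ) :=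
  ∑ e : E, Finsupp.lsingle e

/-- The relative augmentation `ε_{Λ/R} : ℤ[Λ] → ℤ[R]`, `λ ↦ π(λ)`. -/
noncomputable def epsRel {Λ R : Type} (π : Λ → R) : (Λ →₀ ℤ) →ₗ[ℤ] (R →₀ ℤ) :=
  Finsupp.lmapDomain ℤ ℤ π

/-- The relative norm `ν_{Λ/R} : ℤ[R] → ℤ[Λ]`, `r ↦ Σ_{π(λ) = r} λ`. -/
noncomputable def nuRel {Λ R : Type} [Fintype Λ] [DecidableEq R] (π : Λ → R) :
    (R →₀ ℤ) →ₗ[ℤ] (Λ →₀ ℤ) :=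
  Finsupp.lsum ℤ fun r => ∑ l ∈ Finset.univ.filter fun l => π l = r, Finsupp.lsingle l

/-- The map `σ : ℤ[Λ] → ℤ[X]`, `λ ↦ Σ_{x ∈ λ} x`. -/
noncomputable def sigmaMap (X : Type) [Fintype X] [DecidableEq X] :
    (Pairs X →₀ ℤ) →ₗ[ℤ] (X →₀ ℤ) :=
  Finsupp.lsum ℤ fun l => ∑ x ∈ (l : Finset X), Finsupp.lsingle x

/-- The map `τ : ℤ[X] → ℤ[Λ]`, `x ↦ Σ_{λ ∋ x} λ`. -/
noncomputable def tauMap (X : Type) [Fintype X] [DecidableEq X] :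
    (X →₀ ℤ) →ₗ[ℤ] (Pairs X →₀ ℤ) :=
  Finsupp.lsum ℤ fun x =>
    ∑ l ∈ Finset.univ.filter fun l : Pairs X => x ∈ (l : Finset X), Finsupp.lsingle l

theorem nuNorm_apply' (E : Type) [Fintype E] (n : ℤ) (e : E) : nuNorm E n e = n := by
  classical
  simp [nuNorm, LinearMap.sum_apply, Finsupp.finsetSum_apply, Finsupp.single_apply]

theorem tauMap_apply' (X : Type) [Fintype X] [DecidableEq X] (f : X →₀ ℤ) (l : Pairs X) :
    tauMap X f l = ∑ x ∈ (l : Finset X), f x := by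
  induction f using Finsupp.induction_linear with
  | zero => simp
  | add f g hf hg => simp [hf, hg, Finset.sum_add_distrib]
  | single a n =>
    simp [tauMap, LinearMap.sum_apply, Finsupp.finsetSum_apply, Finsupp.single_apply]

theorem gammaMap_ne (X : Type) [Fintype X] [DecidableEq X] (hX : Fintype.card X = 4)
    (l : Pairs X) : gammaMap X hX l ≠ l := by
  intro h
  have h1 : (l : Finset X)ᶜ = l := congrArg Subtype.val h
  have hc : (l : Finset X).card = 2 := l.2
  obtain ⟨x, hx⟩ := Finset.card_pos.mp (by omega : 0 < (l : Finset X).card)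
  have hx' : x ∈ (l : Finset X)ᶜ := by rw [h1]; exact hx
  exact Finset.mem_compl.mp hx' hx

theorem epsRel_apply' (X R : Type) [Fintype X] [DecidableEq X]
    (hX : Fintype.card X = 4) (π : Pairs X → R)
    (hπ : ∀ l m : Pairs X, π l = π m ↔ m = l ∨ m = gammaMap X hX l)
    (f : Pairs X →₀ ℤ) (l : Pairs X) :
    epsRel π f (π l) = f l + f (gammaMap X hX l) := by
  classical
  induction f using Finsupp.induction_linear with
  | zero => simp
  | add f g hf hg => rw [map_add, Finsupp.add_apply, hf, hg]; simp; ring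
  | single a n =>
    have h1 := hπ l a
    have h2 := gammaMap_ne X hX l
    simp only [epsRel, Finsupp.lmapDomain_apply, Finsupp.mapDomain_single, Finsupp.single_apply]
    grind

theorem exists_four (X : Type) [Fintype X] [DecidableEq X] (hX : Fintype.card X = 4) :
    ∃ a b c d : X, a ≠ b ∧ a ≠ c ∧ a ≠ d ∧ b ≠ c ∧ b ≠ d ∧ c ≠ d ∧
      ∀ x, x = a ∨ x = b ∨ x = c ∨ x = d := by
  let e := (Fintype.equivFinOfCardEq hX).symm
  refine ⟨e 0, e 1, e 2, e 3, by simp, by simp, by simp, by simp, by simp, by simp, ?_⟩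
  intro x
  obtain ⟨i, rfl⟩ := e.surjective x
  fin_cases i <;> simp

theorem solve_pairs (X : Type) [Fintype X] [DecidableEq X] (hX : Fintype.card X = 4)
    (f : Pairs X →₀ ℤ) (k : ℤ) (hf : ∀ l, f l + f (gammaMap X hX l) = k) :
    ∃ (ξ : X →₀ ℤ) (n : ℤ), ∀ l : Pairs X, ∑ x ∈ (l : Finset X), ξ x + n = f l := by
  obtain ⟨a, b, c, d, hab, hac, had, hbc, hbd, hcd, hall⟩ := exists_four X hX
  let g : X → X → ℤ := fun x y => if h : x ≠ y then f ⟨{x, y}, Finset.card_pair h⟩ else 0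
  have hg : ∀ x y (h : x ≠ y), g x y = f ⟨{x, y}, Finset.card_pair h⟩ := fun x y h => dif_pos h
  have hsymm : ∀ x y, g x y = g y x := by
    intro x y
    by_cases h : x = y
    · rw [h]
    · rw [hg x y h, hg y x (Ne.symm h)]
      congr 2
      exact Finset.pair_comm x y
  have hcompl : ∀ x y z w, x ≠ y → z ≠ w → x ≠ z → x ≠ w → y ≠ z → y ≠ w →
      (∀ t, t = x ∨ t = y ∨ t = z ∨ t = w) → g x y + g z w = k := by
    intro x y z w h1 h2 h3 h4 h5 h6 h7
    rw [← hf ⟨{x, y}, Finset.card_pair h1⟩, hg x y h1, hg z w h2]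
    congr 2
    apply Subtype.ext
    change ({z, w} : Finset X) = ({x, y} : Finset X)ᶜ
    ext t
    have := h7 t
    simp only [Finset.mem_insert, Finset.mem_singleton, Finset.mem_compl]
    grind
  have e1 := hcompl a b c d hab hcd hac had hbc hbd hall
  have e2 := hcompl a c b d hac hbd hab had hbc.symm hcd (fun t => by have := hall t; tauto)
  have e3 := hcompl a d b c had hbc hab hac hbd.symm hcd.symm (fun t => by have := hall t; tauto)
  let n := g a b + g a c - g b c
  let ξ : X →₀ ℤ := Finsupp.equivFunOnFinite.symm fun x => if x = a then 0 else g a x - n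
  have xa : ξ a = 0 := by simp [ξ]
  have xb : ξ b = g a b - n := by simp [ξ, hab.symm]
  have xc : ξ c = g a c - n := by simp [ξ, hac.symm]
  have xd : ξ d = g a d - n := by simp [ξ, had.symm]
  refine ⟨ξ, n, ?_⟩
  rintro ⟨l, hl⟩
  obtain ⟨x, y, hxy, rfl⟩ := Finset.card_eq_two.mp hl
  rw [← hg x y hxy, Finset.sum_pair hxy]
  have s1 := hsymm a b
  have s2 := hsymm a c
  have s3 := hsymm a d
  have s4 := hsymm b c
  have s5 := hsymm b d
  have s6 := hsymm c d
  have hn : n = g a b + g a c - g b c := rfl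
  clear_value n ξ g
  rcases hall x with rfl | rfl | rfl | rfl <;> rcases hall y with rfl | rfl | rfl | rfl <;>
    first | exact absurd rfl hxy | linarith

/-- The sequence `0 → ℤ → ℤ[X] ⊕ ℤ → ℤ[Λ] → J[R] → 0` is exact, where the first map sends
`1` to `(ν_X(1), −2)`, the second sends `(ξ, n)` to `τ(ξ) + ν_Λ(n)`, and the third is the
relative augmentation `ε_{Λ/R}` followed by the quotient map `ℤ[R] → J[R] = coker ν_R`. -/
theorem statement6 (X R : Type) [Fintype X] [DecidableEq X] [Fintype R] [DecidableEq R]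
    (hX : Fintype.card X = 4) (π : Pairs X → R)
    (hπsurj : Surjective π)
    (hπ : ∀ l m : Pairs X, π l = π m ↔ m = l ∨ m = gammaMap X hX l) :
    Injective ((nuNorm X).prod ((-2 : ℤ) • (LinearMap.id : ℤ →ₗ[ℤ] ℤ))) ∧
      LinearMap.range ((nuNorm X).prod ((-2 : ℤ) • (LinearMap.id : ℤ →ₗ[ℤ] ℤ))) =
        LinearMap.ker ((tauMap X) ∘ₗ LinearMap.fst ℤ (X →₀ ℤ) ℤ +
          (nuNorm (Pairs X)) ∘ₗ LinearMap.snd ℤ (X →₀ ℤ) ℤ) ∧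
      LinearMap.range ((tauMap X) ∘ₗ LinearMap.fst ℤ (X →₀ ℤ) ℤ +
          (nuNorm (Pairs X)) ∘ₗ LinearMap.snd ℤ (X →₀ ℤ) ℤ) =
        LinearMap.ker ((LinearMap.range (nuNorm R)).mkQ ∘ₗ epsRel π) ∧
      Surjective ((LinearMap.range (nuNorm R)).mkQ ∘ₗ epsRel π) := by
  have key : ∀ (ξ : X →₀ ℤ) (n : ℤ) (l : Pairs X),
      ((tauMap X) ∘ₗ LinearMap.fst ℤ (X →₀ ℤ) ℤ +
          (nuNorm (Pairs X)) ∘ₗ LinearMap.snd ℤ (X →₀ ℤ) ℤ) (ξ, n) l =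
        ∑ x ∈ (l : Finset X), ξ x + n := by
    intro ξ n l
    simp [tauMap_apply', nuNorm_apply']
  refine ⟨?_, ?_, ?_, ?_⟩
  · intro m n h
    have := congrArg Prod.snd h
    simpa using this
  · ext ⟨ξ, n⟩
    rw [LinearMap.mem_range, LinearMap.mem_ker]
    constructor
    · rintro ⟨m, hm⟩
      have h1 : nuNorm X m = ξ := congrArg Prod.fst hm
      have h2 : -2 * m = n := by simpa using congrArg Prod.snd hm
      ext l
      rw [key, ← h1, ← h2]
      simp [nuNorm_apply', l.2]
    · intro h
      have hp : ∀ x y, x ≠ y → ξ x + ξ y + n = 0 := by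
        intro x y hxy
        have := key ξ n ⟨{x, y}, Finset.card_pair hxy⟩
        rw [h] at this
        simpa [Finset.sum_pair hxy] using this.symm
      obtain ⟨a, b, c, d, hab, hac, had, hbc, hbd, hcd, hall⟩ := exists_four X hX
      have e1 := hp a b hab
      have e2 := hp a c hac
      have e3 := hp a d had
      have e4 := hp b c hbc
      have e5 := hp b d hbd
      have e6 := hp c d hcd
      refine ⟨ξ a, Prod.ext ?_ ?_⟩
      · ext x
        change nuNorm X (ξ a) x = ξ x
        rw [nuNorm_apply']
        rcases hall x with rfl | rfl | rfl | rfl <;> linarith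
      · change (-2 : ℤ) * ξ a = n
        linarith
  · ext f
    rw [LinearMap.mem_range, LinearMap.mem_ker, LinearMap.comp_apply, Submodule.mkQ_apply,
      Submodule.Quotient.mk_eq_zero, LinearMap.mem_range]
    constructor
    · rintro ⟨⟨ξ, n⟩, rfl⟩
      refine ⟨∑ x, ξ x + 2 * n, ?_⟩
      ext r
      obtain ⟨l, rfl⟩ := hπsurj r
      rw [nuNorm_apply', epsRel_apply' X R hX π hπ, key, key,
        ← Finset.sum_add_sum_compl (l : Finset X)]
      simp only [gammaMap]
      ring
    · rintro ⟨k, hk⟩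
      obtain ⟨ξ, n, h⟩ := solve_pairs X hX f k (by
        intro l
        rw [← epsRel_apply' X R hX π hπ, ← hk, nuNorm_apply'])
      refine ⟨(ξ, n), ?_⟩
      ext l
      rw [key, h]
  · rw [LinearMap.coe_comp]
    refine (Submodule.mkQ_surjective _).comp ?_
    exact Finsupp.mapDomain_surjective hπsurj
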